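/- Let G be a tree on n vertices. Then depth(S*/I(G*)^k) = n - k + 1 for all k = 1,...,n, where I(G*) ⊆ S* = K[x_1,...,x_n,y_1,...,y_n] is the edge ideal of the whisker graph G*. -/

import Mathlib

open MvPolynomial

/-- The depth of the module `M` with respect to the ideal `m`: the supremum of the
lengths of `M`-regular sequences consisting of elements of `m`. -/
noncomputable def idealDepth {R : Type*} [CommRing R] (m : Ideal R)
    (M : Type*) [AddCommGroup M] [Module R M] : ℕ :=
  sSup {d : ℕ | ∃ rs : List R, rs.length = d ∧ (∀ r ∈ rs, r ∈ m) ∧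
    RingTheory.Sequence.IsRegular M rs}

/-- The graded maximal ideal of a polynomial ring, generated by all the variables. -/
noncomputable def maxIdeal (σ K : Type*) [Field K] : Ideal (MvPolynomial σ K) :=
  Ideal.span (Set.range X)

/-- The edge ideal of the whisker graph `G*` of a graph `G` on `{1,…,n}`, inside
`S* = K[x_1,…,x_n,y_1,…,y_n]`, where `x_i = X (Sum.inl i)` and `y_i = X (Sum.inr i)`.
It is generated by `x_i x_j` for edges `{i,j}` of `G` and by `x_i y_i` for all `i`. -/
noncomputable def whiskerEdgeIdeal {n : ℕ} (K : Type*) [Field K] (G : SimpleGraph (Fin n)) :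
    Ideal (MvPolynomial (Fin n ⊕ Fin n) K) :=
  Ideal.span ({p | ∃ i j, G.Adj i j ∧ p = X (Sum.inl i) * X (Sum.inl j)} ∪
    Set.range (fun i : Fin n => X (Sum.inl i) * X (Sum.inr i)))

section ExtVanishing

open CategoryTheory Abelian RingTheory.Sequence

universe u

variable {R : Type u} [CommRing R]

/-- The groups `Ext^i(R/I, M)` vanish for all `i < d`. -/
def ExtVanishes (I : Ideal R) (d : ℕ) (M : Type u) [AddCommGroup M] [Module R M] : Prop :=
  ∀ i < d, Subsingleton (Ext (ModuleCat.of R (R ⧸ I)) (ModuleCat.of R M) i)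

variable {I : Ideal R} {d : ℕ} {M N P : Type u} [AddCommGroup M] [Module R M]
  [AddCommGroup N] [Module R N] [AddCommGroup P] [Module R P]

lemma ExtVanishes.mono {e : ℕ} (h : ExtVanishes I d M) (hed : e ≤ d) : ExtVanishes I e M :=
  fun i hi => h i (hi.trans_le hed)

lemma ExtVanishes.of_subsingleton [Subsingleton M] : ExtVanishes I d M := fun i _ => by
  refine subsingleton_of_forall_eq 0 fun x => ?_
  have hz : Limits.IsZero (ModuleCat.of R M) := ModuleCat.isZero_of_subsingleton _
  rw [← Ext.comp_mk₀_id x, hz.eq_of_src (𝟙 _) 0, Ext.mk₀_zero, Ext.comp_zero]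

lemma shortExact_of_exact {f : M →ₗ[R] N} {g : N →ₗ[R] P} (hf : Function.Injective f)
    (hg : Function.Surjective g) (hfg : Function.Exact f g) :
    (ShortComplex.mk (ModuleCat.ofHom f) (ModuleCat.ofHom g)
      (by ext x; exact hfg.apply_apply_eq_zero x)).ShortExact where
  exact := ModuleCat.shortComplex_exact _ hfg
  mono_f := (ModuleCat.mono_iff_injective _).mpr hf
  epi_g := (ModuleCat.epi_iff_surjective _).mpr hg

/-- The depth lemma for the middle term of a short exact sequence. -/
lemma ExtVanishes.of_exact {f : M →ₗ[R] N} {g : N →ₗ[R] P} (hf : Function.Injective f)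
    (hg : Function.Surjective g) (hfg : Function.Exact f g)
    (hM : ExtVanishes I d M) (hP : ExtVanishes I d P) : ExtVanishes I d N := by
  intro i hi
  have zero1 := AddCommGrpCat.isZero_of_iff_subsingleton.mpr (hM i hi)
  have zero2 := AddCommGrpCat.isZero_of_iff_subsingleton.mpr (hP i hi)
  exact AddCommGrpCat.subsingleton_of_isZero <| ShortComplex.Exact.isZero_of_both_zeros
    (Ext.covariant_sequence_exact₂' (ModuleCat.of R (R ⧸ I)) (shortExact_of_exact hf hg hfg) i)
    (zero1.eq_zero_of_src _) (zero2.eq_zero_of_tgt _)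

/-- Modulo a regular element of `I` the vanishing range drops by at most one. -/
lemma ExtVanishes.quotSMulTop {a : R} (ha : IsSMulRegular M a) (h : ExtVanishes I (d + 1) M) :
    ExtVanishes I d (QuotSMulTop a M) := by
  intro i hi
  have zero1 := AddCommGrpCat.isZero_of_iff_subsingleton.mpr (h i (by omega))
  have zero2 := AddCommGrpCat.isZero_of_iff_subsingleton.mpr (h (i + 1) (by omega))
  have ha' : IsSMulRegular (ModuleCat.of R M) a := ha
  exact AddCommGrpCat.subsingleton_of_isZero <| ShortComplex.Exact.isZero_of_both_zeros
    (Ext.covariant_sequence_exact₃' (ModuleCat.of R (R ⧸ I))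
      ha'.smulShortComplex_shortExact i (i + 1) rfl)
    (zero1.eq_zero_of_src _) (zero2.eq_zero_of_tgt _)

/-- If `a ∈ I` acts injectively on `M` with cokernel `P`, the vanishing range of `M` exceeds
that of `P`. -/
lemma ExtVanishes.succ_of_exact {a : R} (haI : a ∈ I) {g : M →ₗ[R] P} (ha : IsSMulRegular M a)
    (hg : Function.Surjective g) (hag : Function.Exact (LinearMap.lsmul R M a) g)
    (h : ExtVanishes I d P) : ExtVanishes I (d + 1) M := by
  have hann : a ∈ Module.annihilator R (ModuleCat.of R (R ⧸ I)) := by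
    change a ∈ Module.annihilator R (R ⧸ I)
    rwa [Ideal.annihilator_quotient]
  intro i hi
  match i with
  | 0 =>
    have : Subsingleton (R ⧸ I →ₗ[R] M) :=
      IsSMulRegular.linearMap_subsingleton_of_mem_annihilator ha hann
    exact (Ext.addEquiv₀.trans ModuleCat.homAddEquiv).subsingleton
  | i + 1 =>
    have hS := shortExact_of_exact (f := LinearMap.lsmul R M a) ha hg hag
    refine ⟨fun x y => ?_⟩
    have key : ∀ x : Ext (ModuleCat.of R (R ⧸ I)) (ModuleCat.of R M) (i + 1), x = 0 := by
      intro x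
      have hx : x.comp (Ext.mk₀ (ModuleCat.ofHom (LinearMap.lsmul R M a)))
          (add_zero (i + 1)) = 0 := by
        have := Ext.postcomp_smul_id_eq_zero_of_mem_annihilator
          (M := ModuleCat.of R M) (N := ModuleCat.of R (R ⧸ I)) hann (i + 1)
        have := ConcreteCategory.congr_hom this x
        exact this
      obtain ⟨z, rfl⟩ := Ext.covariant_sequence_exact₁ _ hS x hx rfl
      have := h i (by omega)
      rw [Subsingleton.elim z 0, Ext.zero_comp]
    rw [key x, key y]

variable [IsNoetherianRing R] [Module.Finite R M]

lemma ExtVanishes.exists_isRegular (hM : I • (⊤ : Submodule R M) < ⊤) (h : ExtVanishes I d M) :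
    ∃ rs : List R, rs.length = d ∧ (∀ r ∈ rs, r ∈ I) ∧ IsRegular M rs :=
  ModuleCat.exists_isRegular_of_exists_subsingleton_ext I d (ModuleCat.of R M) hM
    (ModuleCat.of R (R ⧸ I))
    (by
      rw [Module.support_eq_zeroLocus]
      exact congrArg _ (congrArg _ Ideal.annihilator_quotient)) h

lemma extVanishes_of_isRegular (hM : I • (⊤ : Submodule R M) < ⊤) {rs : List R}
    (hmem : ∀ r ∈ rs, r ∈ I) (hreg : IsRegular M rs) : ExtVanishes I rs.length M :=
  ModuleCat.subsingleton_ext_of_exists_isRegular I (ModuleCat.of R (R ⧸ I))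
    (by rw [Module.support_eq_zeroLocus]
        exact (congrArg _ (congrArg _ Ideal.annihilator_quotient)).subset)
    (ModuleCat.of R M) hM rs hmem hreg

end ExtVanishing

section DepthDimension

open RingTheory.Sequence

variable {R : Type*} [CommRing R] [IsNoetherianRing R] {M : Type*} [AddCommGroup M] [Module R M]
  {m p : Ideal R}

/-- If some `u : M` has `P ≤ ann u ≤ m`, then `M` has an associated prime between `P` and `m`. -/
lemma exists_associatedPrime_between [m.IsPrime] {P : Ideal R} {u : M}
    (hP : ∀ t ∈ P, t • u = 0) (hu : ∀ g : R, g • u = 0 → g ∈ m) :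
    ∃ q ∈ associatedPrimes R M, P ≤ q ∧ q ≤ m := by
  have hle : Module.annihilator R (R ∙ u) ≤ m := fun g hg =>
    hu g ((Submodule.mem_annihilator_span_singleton _ _).mp hg)
  obtain ⟨q, hq, hqm⟩ := Ideal.exists_minimalPrimes_le hle
  have hq' := Module.associatedPrimes.minimalPrimes_annihilator_subset_associatedPrimes R _ hq
  refine ⟨q, associatedPrimes.subset_of_injective (Submodule.injective_subtype _) hq', ?_, hqm⟩
  exact fun t ht => hq.1.2 ((Submodule.mem_annihilator_span_singleton _ _).mpr (hP t ht))

variable [Module.Finite R M]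

lemma exists_associatedPrime_quotSMulTop_gt [m.IsPrime] (hp : p ∈ associatedPrimes R M)
    (hpm : p ≤ m) {a : R} (ham : a ∈ m) (ha : IsSMulRegular M a) :
    ∃ q ∈ associatedPrimes R (QuotSMulTop a M), p < q ∧ q ≤ m := by
  obtain ⟨hpp, u, hu⟩ := Submodule.isAssociatedPrime_iff.mp hp
  have hu' : ∀ r, r ∈ p ↔ r • u = 0 := by
    intro r
    rw [hu, Submodule.mem_colon_singleton, Submodule.mem_bot]
  let N := Submodule.torsionBySet R M p
  have huN : u ∈ N := by
    rw [Submodule.mem_torsionBySet_iff]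
    exact fun r => (hu' r).mp r.2
  have hmN : (⟨m, inferInstance⟩ : PrimeSpectrum R) ∈ Module.support R (QuotSMulTop a N) := by
    rw [Module.support_quotSMulTop]
    refine ⟨Module.mem_support_iff_exists_annihilator.mpr ⟨⟨u, huN⟩, fun r hr => hpm ?_⟩, ?_⟩
    · rw [Submodule.mem_annihilator_span_singleton] at hr
      exact (hu' r).mpr (congrArg Subtype.val hr)
    · simpa using ham
  rw [Module.mem_support_iff_of_finite] at hmN
  obtain ⟨q, hq, hqm⟩ := Ideal.exists_minimalPrimes_le hmN
  have hqN := Module.associatedPrimes.minimalPrimes_annihilator_subset_associatedPrimes R _ hq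
  have haq : a ∈ q := hq.1.2 (by
    rw [Module.mem_annihilator]
    intro x
    obtain ⟨x, rfl⟩ := Submodule.mkQ_surjective _ x
    rw [← map_smul, Submodule.mkQ_apply, Submodule.Quotient.mk_eq_zero]
    exact Submodule.smul_mem_pointwise_smul _ _ _ trivial)
  have hpq : p ≤ q := fun r hr => hq.1.2 (by
    rw [Module.mem_annihilator]
    intro x
    obtain ⟨x, rfl⟩ := Submodule.mkQ_surjective _ x
    have : r • x = 0 := Subtype.ext ((Submodule.mem_torsionBySet_iff _ _).mp x.2 ⟨r, hr⟩)
    rw [← map_smul, this, map_zero])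
  have hap : a ∉ p := fun h => by
    have h0 : u = 0 := ha (by simpa using (hu' a).mp h)
    exact hpp.ne_top ((Ideal.eq_top_iff_one _).mpr ((hu' 1).mpr (by simp [h0])))
  refine ⟨q, associatedPrimes.subset_of_injective (f := QuotSMulTop.map a N.subtype) ?_ hqN,
    lt_of_le_of_ne hpq fun h => hap (h ▸ haq), hqm⟩
  rw [injective_iff_map_eq_zero]
  intro x hx
  obtain ⟨x, rfl⟩ := Submodule.mkQ_surjective _ x
  change Submodule.Quotient.mk (x : M) = 0 at hx
  rw [Submodule.Quotient.mk_eq_zero, Submodule.mem_smul_pointwise_iff_exists] at hx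
  obtain ⟨y, -, hy⟩ := hx
  have hyN : y ∈ N := by
    rw [Submodule.mem_torsionBySet_iff]
    intro r
    have h1 : r.1 • (x : M) = 0 := (Submodule.mem_torsionBySet_iff _ _).mp x.2 r
    refine ha ?_
    change a • (r.1 • y) = a • 0
    rw [smul_comm, hy, h1, smul_zero]
  rw [Submodule.mkQ_apply, Submodule.Quotient.mk_eq_zero, Submodule.mem_smul_pointwise_iff_exists]
  exact ⟨⟨y, hyN⟩, trivial, Subtype.ext hy⟩

/-- The length of a regular sequence in `m` is at most `dim R/p` for every associated
prime `p ≤ m`. -/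
lemma length_le_ringKrullDim_of_associatedPrime [m.IsPrime] {rs : List R}
    (hmem : ∀ r ∈ rs, r ∈ m) (hreg : IsWeaklyRegular M rs) (hp : p ∈ associatedPrimes R M)
    (hpm : p ≤ m) : (rs.length : WithBot ℕ∞) ≤ ringKrullDim (R ⧸ p) := by
  induction rs generalizing M p with
  | nil =>
    have := hp.isPrime
    simp [ringKrullDim_nonneg_of_nontrivial]
  | cons a rs ih =>
    rw [isWeaklyRegular_cons_iff] at hreg
    obtain ⟨q, hq, hpq, hqm⟩ := exists_associatedPrime_quotSMulTop_gt hp hpm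
      (hmem a (by simp)) hreg.1
    have h1 := ih (fun r hr => hmem r (by simp [hr])) hreg.2 hq hqm
    have := hp.isPrime
    obtain ⟨b, hbq, hbp⟩ := SetLike.exists_of_lt hpq
    have h2 : ringKrullDim (R ⧸ q) + 1 ≤ ringKrullDim (R ⧸ p) :=
      ringKrullDim_succ_le_of_surjective (Ideal.Quotient.factor hpq.le)
        (Ideal.Quotient.factor_surjective hpq.le) (r := Ideal.Quotient.mk p b)
        (mem_nonZeroDivisors_of_ne_zero (by rwa [Ne, Ideal.Quotient.eq_zero_iff_mem]))
        (by simpa [Ideal.Quotient.eq_zero_iff_mem] using hbq)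
    refine le_trans ?_ h2
    push_cast [List.length_cons]
    gcongr

lemma length_le_ringKrullDim_of_smul_eq_zero [m.IsPrime] {P : Ideal R} {u : M} {rs : List R}
    (hmem : ∀ r ∈ rs, r ∈ m) (hreg : IsWeaklyRegular M rs) (hP : ∀ t ∈ P, t • u = 0)
    (hu : ∀ g : R, g • u = 0 → g ∈ m) :
    (rs.length : WithBot ℕ∞) ≤ ringKrullDim (R ⧸ P) := by
  obtain ⟨q, hq, hPq, hqm⟩ := exists_associatedPrime_between hP hu
  exact (length_le_ringKrullDim_of_associatedPrime hmem hreg hq hqm).trans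
    (ringKrullDim_le_of_surjective _ (Ideal.Quotient.factor_surjective hPq))

end DepthDimension

section DepthUpperBound

open RingTheory.Sequence

universe u

lemma Ideal.smul_top_lt_top_of_surjective {R M : Type*} [CommRing R] [AddCommGroup M] [Module R M]
    {m : Ideal R} (hm : m ≠ ⊤) (f : M →ₗ[R] R ⧸ m) (hf : Function.Surjective f) :
    m • (⊤ : Submodule R M) < ⊤ := by
  refine lt_top_iff_ne_top.mpr fun h => hm ?_
  have h1 : Submodule.map f (m • ⊤) = ⊤ := by
    rw [h, Submodule.map_top, LinearMap.range_eq_top.mpr hf]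
  rw [Submodule.map_smul'', Submodule.map_top, LinearMap.range_eq_top.mpr hf] at h1
  have h2 : m • (⊤ : Submodule R (R ⧸ m)) ≤ ⊥ := Submodule.smul_le.mpr fun r hr x _ => by
    obtain ⟨x, rfl⟩ := Ideal.Quotient.mk_surjective x
    exact Ideal.Quotient.eq_zero_iff_mem.mpr (m.mul_mem_right x hr)
  have h3 : Ideal.Quotient.mk m 1 ∈ (⊥ : Submodule R (R ⧸ m)) :=
    h2 (by
      rw [h1]
      exact Submodule.mem_top)
  exact (Ideal.eq_top_iff_one _).mpr (Ideal.Quotient.eq_zero_iff_mem.mp h3)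

variable {R : Type u} [CommRing R] [IsNoetherianRing R] {m Q P₁ P₂ : Ideal R}

/-- Let `e` be an element with `P₁ P₂ e ⊆ Q`. If `e` is not, locally at `m`, a sum of an element
of `(Q : P₁)` and an element of `(Q : P₂)`, then the depth of `R/Q` exceeds `dim R/(P₁ + P₂)` by
at most one. -/
lemma length_le_ringKrullDim_add_one [m.IsPrime] (hQm : Q ≤ m) (hP₁ : P₁ ≤ m) (hP₂ : P₂ ≤ m)
    {e : R} (he : ∀ s ∈ P₁, ∀ t ∈ P₂, s * t * e ∈ Q)
    (hsplit : ∀ g v, (∀ t ∈ P₁, t * (g * e - v) ∈ Q) → (∀ t ∈ P₂, t * v ∈ Q) → g ∈ m)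
    (hsocle : ∀ f ∉ Q, (∀ t ∈ P₁ ⊔ P₂, t * f ∈ Q) →
      ∃ f', (∀ t ∈ P₁ ⊔ P₂, t * f' ∈ Q) ∧ ∀ g, g * f' ∈ Q → g ∈ m)
    {rs : List R} (hmem : ∀ r ∈ rs, r ∈ m) (hreg : IsRegular (R ⧸ Q) rs) :
    (rs.length : WithBot ℕ∞) ≤ ringKrullDim (R ⧸ (P₁ ⊔ P₂)) + 1 := by
  have hm : m ≠ ⊤ := Ideal.IsPrime.ne_top'
  have hPm : P₁ ⊔ P₂ ≤ m := sup_le hP₁ hP₂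
  have hle : ringKrullDim (R ⧸ (P₁ ⊔ P₂)) ≤ ringKrullDim (R ⧸ (P₁ ⊔ P₂)) + 1 :=
    le_add_of_nonneg_right zero_le_one
  by_cases hreg_el : ∃ a ∈ P₁ ⊔ P₂, IsSMulRegular (R ⧸ Q) a
  · obtain ⟨a, haP, ha⟩ := hreg_el
    have hlt : m • (⊤ : Submodule R (R ⧸ Q)) < ⊤ :=
      Ideal.smul_top_lt_top_of_surjective hm (Submodule.factor hQm)
        (Submodule.factor_surjective hQm)
    let φ : QuotSMulTop a (R ⧸ Q) →ₗ[R] R ⧸ m := Submodule.liftQ _ (Submodule.factor hQm) (by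
      intro x hx
      obtain ⟨y, -, rfl⟩ := Submodule.mem_smul_pointwise_iff_exists _ _ _ |>.mp hx
      obtain ⟨y, rfl⟩ := Ideal.Quotient.mk_surjective y
      rw [LinearMap.mem_ker, map_smul]
      change Ideal.Quotient.mk m (a * y) = 0
      exact Ideal.Quotient.eq_zero_iff_mem.mpr (m.mul_mem_right _ (hPm haP)))
    have hφ : Function.Surjective φ := fun x => by
      obtain ⟨x, rfl⟩ := Ideal.Quotient.mk_surjective x
      exact ⟨Submodule.Quotient.mk (Ideal.Quotient.mk Q x), rfl⟩
    have hext := extVanishes_of_isRegular hlt hmem hreg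
    cases h : rs.length with
    | zero => 
      have : Nontrivial (R ⧸ (P₁ ⊔ P₂)) :=
        Ideal.Quotient.nontrivial_iff.mpr (ne_top_of_le_ne_top hm hPm)
      exact (ringKrullDim_nonneg_of_nontrivial.trans hle)
    | succ d =>
      rw [h] at hext
      obtain ⟨rs', hlen, hmem', hreg'⟩ := (hext.quotSMulTop ha).exists_isRegular
        (Ideal.smul_top_lt_top_of_surjective hm φ hφ)
      obtain ⟨p₁, hp₁, p₂, hp₂, rfl⟩ := Submodule.mem_sup.mp haP
      let π : R → QuotSMulTop (p₁ + p₂) (R ⧸ Q) :=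
        fun x => Submodule.Quotient.mk (Ideal.Quotient.mk Q x)
      have hπ : ∀ x, π x = 0 ↔ ∃ v, (p₁ + p₂) * v - x ∈ Q := by
        intro x
        rw [Submodule.Quotient.mk_eq_zero, Submodule.mem_smul_pointwise_iff_exists]
        constructor
        · rintro ⟨v, -, hv⟩
          obtain ⟨v, rfl⟩ := Ideal.Quotient.mk_surjective v
          exact ⟨v, Ideal.Quotient.eq.mp hv⟩
        · rintro ⟨v, hv⟩
          exact ⟨Ideal.Quotient.mk Q v, trivial, Ideal.Quotient.eq.mpr hv⟩
      have hreg_mem : ∀ x, (p₁ + p₂) * x ∈ Q → x ∈ Q :=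
        fun x hx => mem_of_isSMulRegular_quotient_of_smul_mem ha hx
      have key := length_le_ringKrullDim_of_smul_eq_zero (u := π (p₁ * e)) (P := P₁ ⊔ P₂) hmem'
        hreg'.toIsWeaklyRegular ?_ ?_
      · rw [hlen] at key
        push_cast
        gcongr
      · intro t ht
        change π (t * (p₁ * e)) = 0
        rw [hπ]
        obtain ⟨t₁, ht₁, t₂, ht₂, rfl⟩ := Submodule.mem_sup.mp ht
        refine ⟨t₁ * e, ?_⟩
        have h1 := he t₁ ht₁ p₂ hp₂
        have h2 := he p₁ hp₁ t₂ ht₂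
        convert Q.sub_mem h1 h2 using 1
        ring
      · intro g hg
        change π (g * (p₁ * e)) = 0 at hg
        obtain ⟨v, hv⟩ := (hπ _).mp hg
        refine hsplit g v (fun t ht => hreg_mem _ ?_) (fun t ht => hreg_mem _ ?_)
        · have h1 := he t ht p₂ hp₂
          convert Q.sub_mem (Q.mul_mem_left g h1) (Q.mul_mem_left t hv) using 1
          ring
        · have h1 := he p₁ hp₁ t ht
          convert Q.add_mem (Q.mul_mem_left g h1) (Q.mul_mem_left t hv) using 1
          ring
  · refine le_trans ?_ hle
    have hhom : ¬ Subsingleton (R ⧸ (P₁ ⊔ P₂) →ₗ[R] R ⧸ Q) := by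
      rw [IsSMulRegular.subsingleton_linearMap_iff, Ideal.annihilator_quotient]
      exact hreg_el
    rw [not_subsingleton_iff_nontrivial] at hhom
    obtain ⟨φ, hφ⟩ := exists_ne (0 : R ⧸ (P₁ ⊔ P₂) →ₗ[R] R ⧸ Q)
    obtain ⟨f, hf⟩ := Ideal.Quotient.mk_surjective (φ 1)
    have hmk : ∀ t, φ (Ideal.Quotient.mk _ t) = Ideal.Quotient.mk Q (t * f) := by
      intro t
      rw [map_mul, hf]
      change _ = t • φ 1
      rw [← map_smul]
      congr 1
      exact (mul_one (Ideal.Quotient.mk (P₁ ⊔ P₂) t)).symm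
    have hfQ : f ∉ Q := fun h => hφ <| by
      ext
      simpa [Ideal.Quotient.eq_zero_iff_mem.mpr h] using hmk 1
    obtain ⟨f', hf', hg⟩ := hsocle f hfQ fun t ht => by
      have := hmk t
      rwa [Ideal.Quotient.eq_zero_iff_mem.mpr ht, map_zero, eq_comm,
        Ideal.Quotient.eq_zero_iff_mem] at this
    refine length_le_ringKrullDim_of_smul_eq_zero (u := Ideal.Quotient.mk Q f') hmem
      hreg.toIsWeaklyRegular (fun t ht => ?_) (fun g h => ?_)
    · exact Ideal.Quotient.eq_zero_iff_mem.mpr (hf' t ht)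
    · exact hg g (Ideal.Quotient.eq_zero_iff_mem.mp h)

end DepthUpperBound

section MonomialIdeal

universe u

variable {σ : Type} {K : Type u} [Field K] {U V W : Set (σ →₀ ℕ)} {d : ℕ}

lemma mem_maxIdeal_iff {p : MvPolynomial σ K} : p ∈ maxIdeal σ K ↔ coeff 0 p = 0 := by
  rw [maxIdeal, ← Set.image_univ, mem_ideal_span_X_image]
  constructor
  · intro h
    by_contra h0
    obtain ⟨i, -, hi⟩ := h 0 (mem_support_iff.mpr h0)
    exact hi rfl
  · intro h m hm
    have : m ≠ 0 := by
      rintro rfl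
      exact mem_support_iff.mp hm h
    obtain ⟨i, hi⟩ := Finsupp.ne_iff.mp this
    exact ⟨i, trivial, hi⟩

lemma isPrime_maxIdeal : (maxIdeal σ K).IsPrime := by
  have : maxIdeal σ K = RingHom.ker (constantCoeff (R := K) (σ := σ)) := by
    ext p
    rw [mem_maxIdeal_iff, RingHom.mem_ker, constantCoeff_eq]
  rw [this]
  exact RingHom.ker_isPrime _

variable (K) in
/-- The ideal spanned by the monomials with exponent in `U`. -/
noncomputable def monoIdeal (U : Set (σ →₀ ℕ)) : Ideal (MvPolynomial σ K) :=
  Ideal.span ((fun s => monomial s 1) '' U)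

lemma mem_monoIdeal (hU : IsUpperSet U) {p : MvPolynomial σ K} :
    p ∈ monoIdeal K U ↔ ∀ s, coeff s p ≠ 0 → s ∈ U := by
  rw [monoIdeal, mem_ideal_span_monomial_image]
  simp only [mem_support_iff]
  exact forall₂_congr fun s _ => ⟨fun ⟨t, ht, hts⟩ => hU hts ht, fun h => ⟨s, h, le_rfl⟩⟩

lemma monomial_mem_monoIdeal (hU : IsUpperSet U) {s : σ →₀ ℕ} :
    (monomial s 1 : MvPolynomial σ K) ∈ monoIdeal K U ↔ s ∈ U := by
  classical
  rw [mem_monoIdeal hU]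
  refine ⟨fun h => h s (by simp), fun h t ht => ?_⟩
  rw [coeff_monomial] at ht
  exact (ite_ne_right_iff.mp ht).1 ▸ h

lemma monomial_mul_mem_monoIdeal (hU : IsUpperSet U) {f : σ →₀ ℕ} {p : MvPolynomial σ K} :
    monomial f 1 * p ∈ monoIdeal K U ↔ ∀ s, coeff s p ≠ 0 → s + f ∈ U := by
  classical
  rw [mem_monoIdeal hU]
  constructor
  · intro h s hs
    refine h _ ?_
    rwa [add_comm, coeff_monomial_mul, one_mul]
  · intro h s hs
    rw [coeff_monomial_mul'] at hs
    obtain ⟨hfs, hs⟩ := ite_ne_right_iff.mp hs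
    rw [one_mul] at hs
    simpa [tsub_add_cancel_of_le hfs] using h _ hs

variable (K) in
/-- The depth of the quotient by the ideal spanned by the monomials in `U` is at least `d`, in the
sense that the groups `Ext^i(K, S/U)` vanish for `i < d`. -/
def MonoDepth (d : ℕ) (U : Set (σ →₀ ℕ)) : Prop :=
  ExtVanishes (maxIdeal σ K) d (MvPolynomial σ K ⧸ monoIdeal K U)

lemma MonoDepth.mono {e : ℕ} (h : MonoDepth K d U) (hed : e ≤ d) : MonoDepth K e U :=
  ExtVanishes.mono h hed

lemma monoDepth_univ : MonoDepth K d (Set.univ : Set (σ →₀ ℕ)) := by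
  have h : monoIdeal K (Set.univ : Set (σ →₀ ℕ)) = ⊤ :=
    (Ideal.eq_top_iff_one _).mpr (Ideal.subset_span ⟨0, trivial, rfl⟩)
  have : Subsingleton (MvPolynomial σ K ⧸ monoIdeal K (Set.univ : Set (σ →₀ ℕ))) :=
    Ideal.Quotient.subsingleton_iff.mpr h
  exact ExtVanishes.of_subsingleton

lemma monoIdeal_exact (hU : IsUpperSet U) (f : σ →₀ ℕ) (hW : ∀ u, u ∈ W ↔ u ∈ U ∨ f ≤ u)
    (p : MvPolynomial σ K) :
    p ∈ monoIdeal K W ↔ ∃ q, monomial f 1 * q - p ∈ monoIdeal K U := by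
  have hWU : IsUpperSet W := fun a b hab ha => by
    rw [hW] at ha ⊢
    exact ha.imp (hU hab) fun h => h.trans hab
  constructor
  · intro h
    refine ⟨divMonomial p f, ?_⟩
    rw [mem_monoIdeal hWU] at h
    have h1 := divMonomial_add_modMonomial p f
    have h2 : modMonomial p f ∈ monoIdeal K U := by
      rw [mem_monoIdeal hU]
      intro s hs
      by_cases hfs : f ≤ s
      · exact absurd (coeff_modMonomial_of_le _ hfs) hs
      · rw [coeff_modMonomial_of_not_le _ hfs] at hs
        exact ((hW s).mp (h s hs)).resolve_right hfs
    rw [← neg_mem_iff]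
    convert h2 using 1
    nth_rw 2 [← h1]
    ring
  · rintro ⟨q, hq⟩
    have h1 : monomial f 1 * q ∈ monoIdeal K W := by
      rw [monomial_mul_mem_monoIdeal hWU]
      exact fun s _ => (hW _).mpr (Or.inr le_add_self)
    have h2 : monomial f 1 * q - p ∈ monoIdeal K W :=
      Ideal.span_mono (Set.image_mono fun u hu => (hW u).mpr (Or.inl hu)) hq
    simpa using sub_mem h1 h2

/-- The depth lemma for `0 → S/(I : f) → S/I → S/(I + f) → 0`. -/
lemma MonoDepth.of_colon (hU : IsUpperSet U) (f : σ →₀ ℕ) (hV : ∀ u, u ∈ V ↔ u + f ∈ U)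
    (hW : ∀ u, u ∈ W ↔ u ∈ U ∨ f ≤ u) (h₁ : MonoDepth K d V) (h₂ : MonoDepth K d W) :
    MonoDepth K d U := by
  have hVU : IsUpperSet V := fun a b hab ha => by
    rw [hV] at ha ⊢
    exact hU (add_le_add_left hab f) ha
  have hmul : ∀ p, p ∈ monoIdeal K V ↔ monomial f 1 * p ∈ monoIdeal K U := fun p => by
    rw [monomial_mul_mem_monoIdeal hU, mem_monoIdeal hVU]
    exact forall₂_congr fun s _ => hV s
  have hUW : monoIdeal K U ≤ monoIdeal K W :=
    Ideal.span_mono (Set.image_mono fun u hu => (hW u).mpr (Or.inl hu))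
  let φ := Submodule.mapQ (monoIdeal K V) (monoIdeal K U)
    (LinearMap.lsmul (MvPolynomial σ K) (MvPolynomial σ K) (monomial f 1))
    fun p hp => (hmul p).mp hp
  refine ExtVanishes.of_exact (f := φ) (g := Submodule.factor hUW) ?_
    (Submodule.factor_surjective hUW) ?_ h₁ h₂
  · rw [injective_iff_map_eq_zero]
    intro x hx
    obtain ⟨p, rfl⟩ := Ideal.Quotient.mk_surjective x
    exact Ideal.Quotient.eq_zero_iff_mem.mpr ((hmul p).mpr (Ideal.Quotient.eq_zero_iff_mem.mp hx))
  · intro x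
    obtain ⟨p, rfl⟩ := Ideal.Quotient.mk_surjective x
    refine (Ideal.Quotient.eq_zero_iff_mem (I := monoIdeal K W)).trans
      ((monoIdeal_exact hU f hW p).trans ⟨?_, ?_⟩)
    · rintro ⟨q, hq⟩
      exact ⟨Ideal.Quotient.mk _ q, Ideal.Quotient.eq.mpr hq⟩
    · rintro ⟨q, hq⟩
      obtain ⟨q, rfl⟩ := Ideal.Quotient.mk_surjective q
      exact ⟨q, Ideal.Quotient.eq.mp hq⟩

/-- A variable that is regular modulo the monomial ideal increases the depth. -/
lemma MonoDepth.succ (hU : IsUpperSet U) (i : σ) (hreg : ∀ u, u + Finsupp.single i 1 ∈ U → u ∈ U)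
    (hW : ∀ u, u ∈ W ↔ u ∈ U ∨ Finsupp.single i 1 ≤ u) (h : MonoDepth K d W) :
    MonoDepth K (d + 1) U := by
  have hUW : monoIdeal K U ≤ monoIdeal K W :=
    Ideal.span_mono (Set.image_mono fun u hu => (hW u).mpr (Or.inl hu))
  have hX : (X i : MvPolynomial σ K) ∈ maxIdeal σ K := Ideal.subset_span ⟨i, rfl⟩
  refine ExtVanishes.succ_of_exact hX (g := Submodule.factor hUW) ?_
    (Submodule.factor_surjective hUW) ?_ h
  · refine isSMulRegular_iff_right_eq_zero_of_smul.mpr fun x hx => ?_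
    obtain ⟨p, rfl⟩ := Ideal.Quotient.mk_surjective x
    have hx : X i * p ∈ monoIdeal K U := Ideal.Quotient.eq_zero_iff_mem.mp hx
    refine Ideal.Quotient.eq_zero_iff_mem.mpr ?_
    rw [X, monomial_mul_mem_monoIdeal hU] at hx
    rw [mem_monoIdeal hU]
    exact fun s hs => hreg s (hx s hs)
  · intro x
    obtain ⟨p, rfl⟩ := Ideal.Quotient.mk_surjective x
    refine (Ideal.Quotient.eq_zero_iff_mem (I := monoIdeal K W)).trans
      ((monoIdeal_exact hU _ hW p).trans ⟨?_, ?_⟩)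
    · rintro ⟨q, hq⟩
      exact ⟨Ideal.Quotient.mk _ q, Ideal.Quotient.eq.mpr hq⟩
    · rintro ⟨q, hq⟩
      obtain ⟨q, rfl⟩ := Ideal.Quotient.mk_surjective q
      exact ⟨q, Ideal.Quotient.eq.mp hq⟩

/-- The exponents of monomials divisible by a variable in `Z`. -/
def meets (Z : Finset σ) : Set (σ →₀ ℕ) := {u | ∃ z ∈ Z, u z ≠ 0}

lemma isUpperSet_meets (Z : Finset σ) : IsUpperSet (meets Z) := fun _ _ hab ⟨z, hz, h⟩ =>
  ⟨z, hz, (Nat.pos_of_ne_zero h).trans_le (hab z) |>.ne'⟩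

lemma single_le_iff_ne_zero {i : σ} {u : σ →₀ ℕ} : Finsupp.single i 1 ≤ u ↔ u i ≠ 0 := by
  rw [Finsupp.single_le_iff, Nat.one_le_iff_ne_zero]

lemma monoDepth_meets [Fintype σ] [DecidableEq σ] (Z : Finset σ) :
    MonoDepth K (Fintype.card σ - Z.card) (meets Z) := by
  induction h : Fintype.card σ - Z.card generalizing Z with
  | zero => exact fun i hi => absurd hi (Nat.not_lt_zero i)
  | succ d ih =>
    obtain ⟨i, hi⟩ : ∃ i, i ∉ Z := by
      by_contra! hZ
      rw [Finset.eq_univ_of_forall hZ, Finset.card_univ] at h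
      omega
    refine MonoDepth.succ (isUpperSet_meets Z) i ?_ ?_ (ih (insert i Z) ?_)
    · rintro u ⟨z, hz, h⟩
      refine ⟨z, hz, ?_⟩
      rwa [Finsupp.add_apply, Finsupp.single_eq_of_ne (by rintro rfl; exact hi hz), add_zero] at h
    · intro u
      rw [single_le_iff_ne_zero]
      simp [meets, or_comm]
    · rw [Finset.card_insert_of_notMem hi]
      omega

/-- The exponents of monomials in the `k`-th power of the ideal spanned by the monomials `E`. -/
def powSet (E : Set (σ →₀ ℕ)) : ℕ → Set (σ →₀ ℕ)
  | 0 => Set.univ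
  | k + 1 => {u | ∃ g ∈ E, ∃ v ∈ powSet E k, v + g ≤ u}

variable {E F : Set (σ →₀ ℕ)} {k : ℕ} {u v g : σ →₀ ℕ}

lemma isUpperSet_powSet (E : Set (σ →₀ ℕ)) (k : ℕ) : IsUpperSet (powSet E k) := by
  cases k with
  | zero => exact isUpperSet_univ
  | succ k => exact fun a b hab ⟨g, hg, v, hv, h⟩ => ⟨g, hg, v, hv, h.trans hab⟩

lemma add_mem_powSet_succ (hu : u ∈ powSet E k) (hg : g ∈ E) : u + g ∈ powSet E (k + 1) :=
  ⟨g, hg, u, hu, le_rfl⟩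

lemma mem_powSet_of_mem_succ (h : u ∈ powSet E (k + 1)) : u ∈ powSet E k := by
  obtain ⟨g, -, v, hv, h⟩ := h
  exact isUpperSet_powSet E k (le_self_add.trans h) hv

lemma powSet_restrict (h : u ∈ powSet E k) (hEF : ∀ g ∈ E, g ≤ u → g ∈ F) : u ∈ powSet F k := by
  induction k generalizing u with
  | zero => trivial
  | succ k ih =>
    obtain ⟨g, hg, v, hv, h⟩ := h
    exact ⟨g, hEF g hg (le_add_self.trans h), v,
      ih hv (fun g' hg' hle => hEF g' hg' (hle.trans (le_self_add.trans h))), h⟩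

lemma powSet_mono (hEF : E ⊆ F) : powSet E k ⊆ powSet F k :=
  fun _ h => powSet_restrict h fun _ hg _ => hEF hg

/-- A member of `powSet E (k+1)` either uses a generator outside `F` or only generators in `F`. -/
lemma powSet_dichotomy (F : Set (σ →₀ ℕ)) (h : u ∈ powSet E (k + 1)) :
    u ∈ powSet (E ∩ F) (k + 1) ∨ ∃ g ∈ E, g ∉ F ∧ ∃ v ∈ powSet E k, v + g ≤ u := by
  induction k generalizing u with
  | zero =>
    obtain ⟨g, hg, v, hv, h⟩ := h
    by_cases hgF : g ∈ F
    · exact Or.inl ⟨g, ⟨hg, hgF⟩, v, hv, h⟩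
    · exact Or.inr ⟨g, hg, hgF, v, hv, h⟩
  | succ k ih =>
    obtain ⟨g, hg, v, hv, h⟩ := h
    by_cases hgF : g ∈ F
    · rcases ih hv with h' | ⟨g', hg', hg'F, v', hv', h'⟩
      · exact Or.inl ⟨g, ⟨hg, hgF⟩, v, h', h⟩
      · refine Or.inr ⟨g', hg', hg'F, v' + g, add_mem_powSet_succ hv' hg, ?_⟩
        rw [add_right_comm]
        exact (add_le_add_left h' g).trans h
    · exact Or.inr ⟨g, hg, hgF, v, hv, h⟩

lemma powSet_congr_of_ne {i : σ} (hE : ∀ g ∈ E, g i = 0) (h : u ∈ powSet E k)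
    (huv : ∀ j ≠ i, u j ≤ v j) : v ∈ powSet E k := by
  classical
  induction k generalizing u v with
  | zero => trivial
  | succ k ih =>
    obtain ⟨g, hg, w, hw, h⟩ := h
    refine ⟨g, hg, w.erase i, ih hw fun j hj => ?_, fun j => ?_⟩
    · rw [Finsupp.erase_ne hj]
    · by_cases hj : j = i
      · subst hj
        simp [hE g hg]
      · rw [Finsupp.add_apply, Finsupp.erase_ne hj]
        exact (h j).trans (huv j hj)

/-- If `u + i ∈ powSet E (k+1)`, then either the variable `i` is not needed at all or it is
contained in one of the generators used. -/
lemma powSet_split (i : σ) (h : u + Finsupp.single i 1 ∈ powSet E (k + 1)) :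
    u ∈ powSet (E ∩ {g | g i = 0}) (k + 1) ∨
      ∃ g ∈ E, g i ≠ 0 ∧ ∃ v ∈ powSet E k, v + g ≤ u + Finsupp.single i 1 := by
  refine (powSet_dichotomy {g | g i = 0} h).imp_left fun h => ?_
  refine powSet_congr_of_ne (fun g hg => hg.2) h fun j hj => ?_
  simp [Finsupp.single_eq_of_ne hj]

lemma mem_powSet_of_add_single (i : σ) (h : u + Finsupp.single i 1 ∈ powSet E (k + 1)) :
    u ∈ powSet E k := by
  rcases powSet_split i h with h | ⟨g, -, hgi, v, hv, h⟩
  · exact mem_powSet_of_mem_succ (powSet_mono Set.inter_subset_left h)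
  · refine isUpperSet_powSet E k ?_ hv
    exact le_of_add_le_add_right
      ((add_le_add_right (single_le_iff_ne_zero.mpr hgi) v).trans h)

lemma le_of_mem_powSet (φ : (σ →₀ ℕ) →+ ℕ) {c : ℕ} (hφ : ∀ g ∈ E, c ≤ φ g) (h : u ∈ powSet E k) :
    k * c ≤ φ u := by
  induction k generalizing u with
  | zero => simp
  | succ k ih =>
    obtain ⟨g, hg, v, hv, h⟩ := h
    obtain ⟨w, rfl⟩ := exists_add_of_le h
    have := ih hv
    have := hφ g hg
    rw [map_add, map_add, add_mul]
    omega

lemma span_monomial_pow (E : Set (σ →₀ ℕ)) (k : ℕ) :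
    Ideal.span ((fun s => monomial s (1 : K)) '' E) ^ k = monoIdeal K (powSet E k) := by
  induction k with
  | zero =>
    rw [pow_zero, Ideal.one_eq_top, eq_comm]
    exact (Ideal.eq_top_iff_one _).mpr (Ideal.subset_span ⟨0, trivial, rfl⟩)
  | succ k ih =>
    rw [pow_succ, ih, monoIdeal, Ideal.span_mul_span']
    apply le_antisymm
    · rw [Ideal.span_le]
      rintro _ ⟨_, ⟨v, hv, rfl⟩, _, ⟨g, hg, rfl⟩, rfl⟩
      refine Ideal.subset_span ⟨v + g, add_mem_powSet_succ hv hg, ?_⟩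
      simp [monomial_mul]
    · rw [monoIdeal, Ideal.span_le]
      rintro _ ⟨u, ⟨g, hg, v, hv, h⟩, rfl⟩
      obtain ⟨w, rfl⟩ := exists_add_of_le h
      have : (monomial (v + g + w) (1 : K)) = monomial w 1 * (monomial v 1 * monomial g 1) := by
        simp [monomial_mul, add_comm]
      change monomial (v + g + w) (1 : K) ∈ _
      rw [this]
      exact Ideal.mul_mem_left _ _ (Ideal.subset_span ⟨_, ⟨v, hv, rfl⟩, _, ⟨g, hg, rfl⟩, rfl⟩)

end MonomialIdeal

section WhiskerGenerators

variable {V : Type} {G : SimpleGraph V} {A : Finset V}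
  {v w : V} {g u : V ⊕ V →₀ ℕ} {k : ℕ}

/-- The exponent of the variable `x_i`. -/
noncomputable abbrev xExp (i : V) : V ⊕ V →₀ ℕ := Finsupp.single (Sum.inl i) 1

/-- The exponent of the variable `y_i`. -/
noncomputable abbrev yExp (i : V) : V ⊕ V →₀ ℕ := Finsupp.single (Sum.inr i) 1

/-- The exponents of the generators of the edge ideal of the whisker graph of `G[A]`. -/
def whiskerGens (G : SimpleGraph V) (A : Finset V) : Set (V ⊕ V →₀ ℕ) :=
  {g | (∃ i ∈ A, ∃ j ∈ A, G.Adj i j ∧ g = xExp i + xExp j) ∨ ∃ i ∈ A, g = xExp i + yExp i}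

lemma whiskerGens_mono {B : Finset V} (h : A ⊆ B) : whiskerGens G A ⊆ whiskerGens G B := by
  rintro g (⟨i, hi, j, hj, hij, rfl⟩ | ⟨i, hi, rfl⟩)
  · exact Or.inl ⟨i, h hi, j, h hj, hij, rfl⟩
  · exact Or.inr ⟨i, h hi, rfl⟩

lemma eq_zero_of_le_of_eq_zero {a : V ⊕ V} (hgu : g ≤ u) (h : u a = 0) : g a = 0 :=
  Nat.le_zero.mp (h ▸ hgu a)

variable [DecidableEq V]

lemma whiskerGens_inr_ne_zero (hg : g ∈ whiskerGens G A) (h : g (Sum.inr w) ≠ 0) :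
    g = xExp w + yExp w := by
  rcases hg with ⟨i, hi, j, hj, hij, rfl⟩ | ⟨i, hi, rfl⟩
  · simp at h
  · by_cases hiw : i = w
    · rw [hiw]
    · simp [hiw] at h

lemma whiskerGens_inl_ne_zero (hg : g ∈ whiskerGens G A) (h : g (Sum.inl w) ≠ 0) :
    w ∈ A ∧ (g = xExp w + yExp w ∨ ∃ j ∈ A, G.Adj w j ∧ g = xExp w + xExp j) := by
  rcases hg with ⟨i, hi, j, hj, hij, rfl⟩ | ⟨i, hi, rfl⟩
  · by_cases hiw : i = w
    · subst hiw
      exact ⟨hi, Or.inr ⟨j, hj, hij, rfl⟩⟩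
    · by_cases hjw : j = w
      · subst hjw
        exact ⟨hj, Or.inr ⟨i, hi, hij.symm, add_comm _ _⟩⟩
      · simp [hiw, hjw] at h
  · by_cases hiw : i = w
    · subst hiw
      exact ⟨hi, Or.inl rfl⟩
    · simp [hiw] at h

lemma mem_whiskerGens_erase (hg : g ∈ whiskerGens G A) (h : g (Sum.inl w) = 0) :
    g ∈ whiskerGens G (A.erase w) := by
  rcases hg with ⟨i, hi, j, hj, hij, rfl⟩ | ⟨i, hi, rfl⟩
  · refine Or.inl ⟨i, Finset.mem_erase.mpr ⟨?_, hi⟩, j, Finset.mem_erase.mpr ⟨?_, hj⟩, hij, rfl⟩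
    · rintro rfl
      simp at h
    · rintro rfl
      simp at h
  · refine Or.inr ⟨i, Finset.mem_erase.mpr ⟨?_, hi⟩, rfl⟩
    rintro rfl
    simp at h

lemma inl_eq_zero_of_notMem (hw : w ∉ A) (hg : g ∈ whiskerGens G A) : g (Sum.inl w) = 0 := by
  by_contra h
  exact hw (whiskerGens_inl_ne_zero hg h).1

lemma powSet_erase (h : u ∈ powSet (whiskerGens G A) k) (hu : u (Sum.inl w) = 0) :
    u ∈ powSet (whiskerGens G (A.erase w)) k :=
  powSet_restrict h fun _ hg hgu => mem_whiskerGens_erase hg (eq_zero_of_le_of_eq_zero hgu hu)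

/-- Colon by a whisker lowers the power by one. -/
lemma add_whisker_mem_powSet_iff (hw : w ∈ A) :
    u + (xExp w + yExp w) ∈ powSet (whiskerGens G A) (k + 1) ↔ u ∈ powSet (whiskerGens G A) k := by
  refine ⟨fun h => ?_, fun h => add_mem_powSet_succ h (Or.inr ⟨w, hw, rfl⟩)⟩
  rw [← add_assoc] at h
  rcases powSet_split _ h with h | ⟨g, hg, hgw, v, hv, h⟩
  · exact mem_powSet_of_add_single _ (powSet_mono Set.inter_subset_left h)
  · rw [whiskerGens_inr_ne_zero hg hgw, ← add_assoc, add_le_add_iff_right,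
      add_le_add_iff_right] at h
    exact isUpperSet_powSet _ _ h hv

/-- For an isolated vertex `w`, colon by `x_w` followed by `y_w = 0` removes `w`. -/
lemma add_xExp_mem_powSet_isolated (hw : ∀ j ∈ A, ¬ G.Adj w j) (hu : u (Sum.inr w) = 0)
    (h : u + xExp w ∈ powSet (whiskerGens G A) k) : u ∈ powSet (whiskerGens G (A.erase w)) k := by
  have h' : u + xExp w ∈ powSet (whiskerGens G (A.erase w)) k := by
    refine powSet_restrict h fun g hg hgu => mem_whiskerGens_erase hg ?_
    by_contra hgw
    rcases (whiskerGens_inl_ne_zero hg hgw).2 with rfl | ⟨j, hj, hwj, -⟩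
    · have := hgu (Sum.inr w)
      simp [hu] at this
    · exact hw j hj hwj
  refine powSet_congr_of_ne (i := Sum.inl w) (fun g hg =>
    inl_eq_zero_of_notMem (Finset.notMem_erase w A) hg) h' fun j hj => ?_
  simp [Finsupp.single_eq_of_ne hj]

/-- For a leaf `w` with neighbour `v`, the condition `y_w = 0` leaves only the edge `{w, v}` among
the generators at `w`. -/
lemma powSet_leaf (hw : ∀ j ∈ A, G.Adj w j → j = v) (hu : u (Sum.inr w) = 0)
    (h : u ∈ powSet (whiskerGens G A) k) :
    u ∈ powSet (insert (xExp w + xExp v) (whiskerGens G (A.erase w))) k := by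
  refine powSet_restrict h fun g hg hgu => ?_
  by_cases hgw : g (Sum.inl w) = 0
  · exact Or.inr (mem_whiskerGens_erase hg hgw)
  · rcases (whiskerGens_inl_ne_zero hg hgw).2 with rfl | ⟨j, hj, hwj, rfl⟩
    · have := hgu (Sum.inr w)
      simp [hu] at this
    · rw [hw j hj hwj]
      exact Or.inl rfl

lemma insert_subset_whiskerGens (hw : w ∈ A) (hv : v ∈ A) (hwv : G.Adj w v) :
    insert (xExp w + xExp v) (whiskerGens G (A.erase w)) ⊆ whiskerGens G A :=
  Set.insert_subset (Or.inl ⟨w, hw, v, hv, hwv, rfl⟩) (whiskerGens_mono (Finset.erase_subset w A))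

lemma add_xExp_mem_powSet_leaf_iff :
    u + xExp w ∈ powSet (insert (xExp w + xExp v) (whiskerGens G (A.erase w))) (k + 1) ↔
      u ∈ powSet (whiskerGens G (A.erase w)) (k + 1) ∨
      ∃ t ∈ powSet (insert (xExp w + xExp v) (whiskerGens G (A.erase w))) k, t + xExp v ≤ u := by
  constructor
  · intro h
    rcases powSet_split _ h with h | ⟨g, hg, hgw, t, ht, h⟩
    · refine Or.inl (powSet_mono ?_ h)
      rintro g ⟨rfl | hg, h0⟩
      · simp at h0
      · exact hg
    · rcases hg with rfl | hg
      · refine Or.inr ⟨t, ht, ?_⟩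
        rwa [add_comm (xExp w), ← add_assoc, add_le_add_iff_right] at h
      · exact absurd (inl_eq_zero_of_notMem (Finset.notMem_erase w A) hg) hgw
  · rintro (h | ⟨t, ht, h⟩)
    · exact isUpperSet_powSet _ _ le_self_add (powSet_mono (Set.subset_insert _ _) h)
    · refine ⟨_, Or.inl rfl, t, ht, ?_⟩
      rw [add_comm (xExp w), ← add_assoc]
      exact add_le_add_left h _

end WhiskerGenerators

lemma SimpleGraph.IsAcyclic.exists_subsingleton_neighbors {V : Type} [Finite V]
    {G : SimpleGraph V} (hG : G.IsAcyclic) {A : Finset V} (hA : A.Nonempty) :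
    ∃ w ∈ A, ∃ v, ∀ j ∈ A, G.Adj w j → j = v := by
  have hne : Nonempty (A : Set V) := hA.to_subtype
  obtain ⟨u, v, p, hp, hmax⟩ :=
    SimpleGraph.Walk.exists_isPath_forall_isPath_length_le_length (G.induce (A : Set V))
  refine ⟨u, u.2, p.snd, fun j hj hadj => ?_⟩
  have hadj' : (G.induce (A : Set V)).Adj u ⟨j, hj⟩ := hadj
  have hmem : ⟨j, hj⟩ ∈ p.support := by
    by_contra hns
    have := hmax _ _ _ (hp.cons (h := hadj'.symm) hns)
    rw [SimpleGraph.Walk.length_cons] at this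
    omega
  exact congrArg Subtype.val ((hG.induce _).eq_snd_of_adj_start hp hadj' hmem)

section LowerBound

universe u

variable {V : Type} {K : Type u} [Field K] {G : SimpleGraph V}
  {A : Finset V} {Z : Finset (V ⊕ V)} {v w : V} {k d : ℕ}

lemma mem_meets_insert {σ : Type} [DecidableEq σ] {Z : Finset σ} {a : σ} {t : σ →₀ ℕ} :
    t ∈ meets (insert a Z) ↔ t a ≠ 0 ∨ t ∈ meets Z := by
  simp [meets]

lemma add_single_mem_meets {σ : Type} {Z : Finset σ} {a : σ} (ha : a ∉ Z)
    {t : σ →₀ ℕ} : t + Finsupp.single a 1 ∈ meets Z ↔ t ∈ meets Z := by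
  refine exists_congr fun z => and_congr_right fun hz => ?_
  rw [Finsupp.add_apply, Finsupp.single_eq_of_ne (by rintro rfl; exact ha hz), add_zero]

lemma isUpperSet_powSet_union_meets (E : Set (V ⊕ V →₀ ℕ)) (k : ℕ) (Z : Finset (V ⊕ V)) :
    IsUpperSet (powSet E k ∪ meets Z) :=
  (isUpperSet_powSet E k).union (isUpperSet_meets Z)

variable [DecidableEq V]

/-- The exponents of the colon ideal `(I^(k+1) : x_w)` modulo `y_w` for a leaf `w` with
neighbour `v`. -/
def leafColon (G : SimpleGraph V) (A : Finset V) (v w : V) (k : ℕ) (Z : Finset (V ⊕ V)) :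
    Set (V ⊕ V →₀ ℕ) :=
  {t | t ∈ powSet (whiskerGens G (A.erase w)) (k + 1) ∨
    (∃ s ∈ powSet (insert (xExp w + xExp v) (whiskerGens G (A.erase w))) k, s + xExp v ≤ t) ∨
    t ∈ meets (insert (Sum.inr w) Z)}

lemma monoDepth_leafColon (hvZ : Sum.inl v ∉ Z)
    (h₁ : MonoDepth K d (powSet (insert (xExp w + xExp v) (whiskerGens G (A.erase w))) k ∪
      meets (insert (Sum.inr w) Z)))
    (h₂ : MonoDepth K d (powSet (whiskerGens G ((A.erase w).erase v)) (k + 1) ∪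
      meets (insert (Sum.inl v) (insert (Sum.inr w) Z)))) :
    MonoDepth K d (leafColon G A v w k Z) := by
  have hv : Sum.inl v ∉ insert (Sum.inr w) Z := by simpa using hvZ
  refine MonoDepth.of_colon ?_ (xExp v) ?_ ?_ h₁ h₂
  · rintro a b hab (h | ⟨s, hs, h⟩ | h)
    · exact Or.inl (isUpperSet_powSet _ _ hab h)
    · exact Or.inr (Or.inl ⟨s, hs, h.trans hab⟩)
    · exact Or.inr (Or.inr (isUpperSet_meets _ hab h))
  · intro t
    constructor
    · rintro (h | h)
      · exact Or.inr (Or.inl ⟨t, h, le_rfl⟩)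
      · exact Or.inr (Or.inr ((add_single_mem_meets hv).mpr h))
    · rintro (h | ⟨s, hs, h⟩ | h)
      · exact Or.inl (powSet_mono (Set.subset_insert _ _) (mem_powSet_of_add_single _ h))
      · exact Or.inl (isUpperSet_powSet _ _ (le_of_add_le_add_right h) hs)
      · exact Or.inr ((add_single_mem_meets hv).mp h)
  · intro t
    rw [single_le_iff_ne_zero, Set.mem_union, mem_meets_insert]
    constructor
    · rintro (h | h | h)
      · exact Or.inl (Or.inl (powSet_mono (whiskerGens_mono (Finset.erase_subset _ _)) h))
      · exact Or.inr h
      · exact Or.inl (Or.inr (Or.inr h))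
    · rintro ((h | ⟨s, hs, h⟩ | h) | h)
      · by_cases hv : t (Sum.inl v) = 0
        · exact Or.inl (powSet_erase h hv)
        · exact Or.inr (Or.inl hv)
      · exact Or.inr (Or.inl (single_le_iff_ne_zero.mp (le_add_self.trans h)))
      · exact Or.inr (Or.inr h)
      · exact Or.inr (Or.inl h)

/-- The depth estimate for the forest obtained by deleting the whisker at a leaf. -/
lemma monoDepth_insert_leaf (hwZ : Sum.inl w ∉ Z)
    (h₁ : MonoDepth K d (leafColon G A v w k Z))
    (h₂ : MonoDepth K d (powSet (whiskerGens G (A.erase w)) (k + 1) ∪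
      meets (insert (Sum.inl w) (insert (Sum.inr w) Z)))) :
    MonoDepth K d (powSet (insert (xExp w + xExp v) (whiskerGens G (A.erase w))) (k + 1) ∪
      meets (insert (Sum.inr w) Z)) := by
  have hw : Sum.inl w ∉ insert (Sum.inr w) Z := by simpa using hwZ
  refine MonoDepth.of_colon (isUpperSet_powSet_union_meets _ _ _) (xExp w) ?_ ?_ h₁ h₂
  · intro t
    rw [Set.mem_union, add_xExp_mem_powSet_leaf_iff, add_single_mem_meets hw, or_assoc]
    rfl
  · intro t
    rw [single_le_iff_ne_zero, Set.mem_union, Set.mem_union, mem_meets_insert (a := Sum.inl w)]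
    constructor
    · rintro (h | h | h)
      · exact Or.inl (Or.inl (powSet_mono (Set.subset_insert _ _) h))
      · exact Or.inr h
      · exact Or.inl (Or.inr h)
    · rintro ((h | h) | h)
      · by_cases hw : t (Sum.inl w) = 0
        · refine Or.inl (powSet_restrict h ?_)
          rintro g (rfl | hg) hgt
          · have := eq_zero_of_le_of_eq_zero hgt hw
            simp at this
          · exact hg
        · exact Or.inr (Or.inl hw)
      · exact Or.inr (Or.inr h)
      · exact Or.inr (Or.inl h)

/-- Reduction of the depth estimate at a vertex `w` to the colon by `x_w` modulo `y_w`. -/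
lemma monoDepth_of_vertex {Q : Set (V ⊕ V →₀ ℕ)} (hwA : w ∈ A) (hxZ : Sum.inl w ∉ Z)
    (hyZ : Sum.inr w ∉ Z)
    (hQ : ∀ t, t ∈ Q ↔ t + xExp w ∈ powSet (whiskerGens G A) (k + 1) ∨
      t ∈ meets (insert (Sum.inr w) Z))
    (h₁ : MonoDepth K d (powSet (whiskerGens G A) k ∪ meets Z)) (h₂ : MonoDepth K d Q)
    (h₃ : MonoDepth K d (powSet (whiskerGens G (A.erase w)) (k + 1) ∪
      meets (insert (Sum.inl w) Z))) :
    MonoDepth K d (powSet (whiskerGens G A) (k + 1) ∪ meets Z) := by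
  have hle : ∀ t : V ⊕ V →₀ ℕ,
      xExp w + yExp w ≤ t ↔ t (Sum.inl w) ≠ 0 ∧ t (Sum.inr w) ≠ 0 := by
    intro t
    constructor
    · exact fun h => ⟨single_le_iff_ne_zero.mp (le_self_add.trans h),
        single_le_iff_ne_zero.mp (le_add_self.trans h)⟩
    · rintro ⟨h1, h2⟩ (i | i)
      · by_cases h : w = i
        · subst h
          simpa using Nat.one_le_iff_ne_zero.mpr h1
        · simp [h]
      · by_cases h : w = i
        · subst h
          simpa using Nat.one_le_iff_ne_zero.mpr h2
        · simp [h]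
  refine MonoDepth.of_colon (isUpperSet_powSet_union_meets _ _ _) (xExp w + yExp w)
    (W := {t | (t ∈ powSet (whiskerGens G A) (k + 1) ∨ t ∈ meets Z) ∨ xExp w + yExp w ≤ t})
    ?_ (fun t => Iff.rfl) h₁ ?_
  · intro t
    rw [Set.mem_union, Set.mem_union, add_whisker_mem_powSet_iff hwA, ← add_assoc,
      add_single_mem_meets hyZ, add_single_mem_meets hxZ]
  · refine MonoDepth.of_colon ?_ (xExp w) ?_ ?_ h₂ h₃
    · rintro a b hab ((h | h) | h)
      · exact Or.inl (Or.inl (isUpperSet_powSet _ _ hab h))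
      · exact Or.inl (Or.inr (isUpperSet_meets _ hab h))
      · exact Or.inr (h.trans hab)
    · intro t
      rw [hQ, mem_meets_insert, Set.mem_ofPred_eq, add_single_mem_meets hxZ, hle, or_assoc]
      simp [or_comm]
    · intro t
      rw [single_le_iff_ne_zero, Set.mem_union, mem_meets_insert, Set.mem_ofPred_eq, hle]
      constructor
      · rintro (h | h | h)
        · refine Or.inl (Or.inl (Or.inl ?_))
          exact powSet_mono (whiskerGens_mono (Finset.erase_subset _ _)) h
        · exact Or.inr h
        · exact Or.inl (Or.inl (Or.inr h))
      · by_cases hw : t (Sum.inl w) = 0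
        · rintro (((h | h) | h) | h)
          · exact Or.inl (powSet_erase h hw)
          · exact Or.inr (Or.inr h)
          · exact absurd hw h.1
          · exact Or.inr (Or.inl h)
        · exact fun _ => Or.inr (Or.inl hw)

variable [Fintype V]

lemma two_mul_card_add_card_le (hZ : ∀ i ∈ A, Sum.inl i ∉ Z ∧ Sum.inr i ∉ Z) :
    2 * A.card + Z.card ≤ 2 * Fintype.card V := by
  have h : Disjoint (A.disjSum A) Z := by
    rw [Finset.disjoint_left]
    rintro (i | i) hi
    · exact (hZ i (by simpa using hi)).1
    · exact (hZ i (by simpa using hi)).2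
  have := Finset.card_le_univ (A.disjSum A ∪ Z)
  rw [Finset.card_union_of_disjoint h, Finset.card_disjSum, Fintype.card_sum] at this
  omega

/-- The depth of the powers of the edge ideal of a whiskered forest is at least what is claimed,
also after killing variables outside of the forest. -/
lemma monoDepth_whisker (hG : G.IsAcyclic) (A : Finset V) (Z : Finset (V ⊕ V))
    (hZ : ∀ i ∈ A, Sum.inl i ∉ Z ∧ Sum.inr i ∉ Z) (k : ℕ) :
    MonoDepth K ((A.card + 1 - k) + (2 * Fintype.card V - 2 * A.card - Z.card))
      (powSet (whiskerGens G A) k ∪ meets Z) := by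
  induction A using Finset.strongInduction generalizing Z k with
  | H A ihA =>
  have hcard := two_mul_card_add_card_le hZ
  have hzero : ∀ (E : Set (V ⊕ V →₀ ℕ)) (Z : Finset (V ⊕ V)) (d : ℕ),
      MonoDepth K d (powSet E 0 ∪ meets Z) := fun E Z d => by
    rw [show powSet E 0 = Set.univ from rfl, Set.univ_union]
    exact monoDepth_univ
  rcases A.eq_empty_or_nonempty with rfl | hA
  · cases k with
    | zero => exact hzero _ _ _
    | succ k =>
      have hE : powSet (whiskerGens G ∅) (k + 1) = ∅ := by
        ext t
        simp [powSet, whiskerGens]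
      rw [hE, Set.empty_union]
      refine (monoDepth_meets Z).mono ?_
      rw [Fintype.card_sum, Finset.card_empty]
      omega
  obtain ⟨w, hw, v, hv⟩ := hG.exists_subsingleton_neighbors hA
  have hcw := Finset.card_erase_of_mem hw
  have hpos := hA.card_pos
  have hwZ := hZ w hw
  have hx : ((insert (Sum.inl w) Z : Finset (V ⊕ V))).card = Z.card + 1 :=
    Finset.card_insert_of_notMem hwZ.1
  have hy : ((insert (Sum.inr w) Z : Finset (V ⊕ V))).card = Z.card + 1 :=
    Finset.card_insert_of_notMem hwZ.2
  have hxy : ((insert (Sum.inl w) (insert (Sum.inr w) Z) : Finset (V ⊕ V))).card = Z.card + 2 := by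
    rw [Finset.card_insert_of_notMem (by simpa using hwZ.1), hy]
  have ih1 : ∀ k, MonoDepth K ((A.card - k) + (2 * Fintype.card V - 2 * A.card - Z.card) + 1)
      (powSet (whiskerGens G (A.erase w)) k ∪ meets (insert (Sum.inl w) Z)) := fun k => by
    refine (ihA _ (Finset.erase_ssubset hw) (insert (Sum.inl w) Z) (fun i hi => ?_) k).mono ?_
    · have := hZ i (Finset.mem_of_mem_erase hi)
      have := Finset.ne_of_mem_erase hi
      simp_all
    · omega
  have ih2 : ∀ k, MonoDepth K ((A.card - k) + (2 * Fintype.card V - 2 * A.card - Z.card) + 1)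
      (powSet (whiskerGens G (A.erase w)) k ∪ meets (insert (Sum.inr w) Z)) := fun k => by
    refine (ihA _ (Finset.erase_ssubset hw) (insert (Sum.inr w) Z) (fun i hi => ?_) k).mono ?_
    · have := hZ i (Finset.mem_of_mem_erase hi)
      have := Finset.ne_of_mem_erase hi
      simp_all
    · omega
  by_cases hvA : v ∈ A ∧ G.Adj w v
  · obtain ⟨hvA, hwv⟩ := hvA
    have hvw : v ∈ A.erase w := Finset.mem_erase.mpr ⟨hwv.ne', hvA⟩
    have hcv := Finset.card_erase_of_mem hvw
    have hpos' : 0 < (A.erase w).card := Finset.card_pos.mpr ⟨v, hvw⟩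
    have hvZ := hZ v hvA
    have hvy : ((insert (Sum.inl v) (insert (Sum.inr w) Z) : Finset (V ⊕ V))).card =
        Z.card + 2 := by
      rw [Finset.card_insert_of_notMem (by simpa using hvZ.1), hy]
    have ih3 : ∀ k, MonoDepth K
        ((A.card - (k + 1)) + (2 * Fintype.card V - 2 * A.card - Z.card) + 2)
        (powSet (whiskerGens G ((A.erase w).erase v)) k ∪
          meets (insert (Sum.inl v) (insert (Sum.inr w) Z))) := fun k => by
      refine (ihA _ ((Finset.erase_ssubset hvw).trans (Finset.erase_ssubset hw))
        (insert (Sum.inl v) (insert (Sum.inr w) Z)) (fun i hi => ?_) k).mono ?_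
      · have := hZ i (Finset.mem_of_mem_erase (Finset.mem_of_mem_erase hi))
        have := Finset.ne_of_mem_erase hi
        have := Finset.ne_of_mem_erase (Finset.mem_of_mem_erase hi)
        simp_all
      · omega
    have ih4 : ∀ k, MonoDepth K ((A.card - k) + (2 * Fintype.card V - 2 * A.card - Z.card))
        (powSet (whiskerGens G (A.erase w)) k ∪
          meets (insert (Sum.inl w) (insert (Sum.inr w) Z))) := fun k => by
      refine (ihA _ (Finset.erase_ssubset hw) (insert (Sum.inl w) (insert (Sum.inr w) Z))
        (fun i hi => ?_) k).mono ?_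
      · have := hZ i (Finset.mem_of_mem_erase hi)
        have := Finset.ne_of_mem_erase hi
        simp_all
      · omega
    have hleaf : ∀ k, MonoDepth K ((A.card - k) + (2 * Fintype.card V - 2 * A.card - Z.card))
        (powSet (insert (xExp w + xExp v) (whiskerGens G (A.erase w))) k ∪
          meets (insert (Sum.inr w) Z)) := fun k => by
      induction k with
      | zero => exact hzero _ _ _
      | succ k ih =>
        refine monoDepth_insert_leaf hwZ.1 (monoDepth_leafColon hvZ.1 (ih.mono ?_)
          ((ih3 (k + 1)).mono ?_)) (ih4 (k + 1)) <;> omega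
    induction k with
    | zero => exact hzero _ _ _
    | succ k ih =>
      refine monoDepth_of_vertex (Q := leafColon G A v w k Z) hw hwZ.1 hwZ.2 ?_ (ih.mono ?_)
        (monoDepth_leafColon hvZ.1 ((hleaf k).mono ?_) ((ih3 (k + 1)).mono ?_))
        ((ih1 (k + 1)).mono ?_)
      · intro t
        rw [leafColon, Set.mem_ofPred_eq, ← or_assoc, ← add_xExp_mem_powSet_leaf_iff]
        constructor
        · exact Or.imp_left fun h => powSet_mono (insert_subset_whiskerGens hw hvA hwv) h
        · rintro (h | h)
          · by_cases hty : t (Sum.inr w) = 0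
            · refine Or.inl (powSet_leaf hv ?_ h)
              simpa using hty
            · exact Or.inr (mem_meets_insert.mpr (Or.inl hty))
          · exact Or.inr h
      all_goals omega
  · have hiso : ∀ j ∈ A, ¬ G.Adj w j := fun j hj hwj => by
      obtain rfl := hv j hj hwj
      exact hvA ⟨hj, hwj⟩
    induction k with
    | zero => exact hzero _ _ _
    | succ k ih =>
      refine monoDepth_of_vertex hw hwZ.1 hwZ.2 ?_ (ih.mono ?_)
        ((ih2 (k + 1)).mono ?_) ((ih1 (k + 1)).mono ?_)
      · intro t
        constructor
        · exact Or.imp_left fun h => isUpperSet_powSet _ _ le_self_add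
            (powSet_mono (whiskerGens_mono (Finset.erase_subset _ _)) h)
        · rintro (h | h)
          · by_cases hty : t (Sum.inr w) = 0
            · exact Or.inl (add_xExp_mem_powSet_isolated hiso hty h)
            · exact Or.inr (mem_meets_insert.mpr (Or.inl hty))
          · exact Or.inr h
      all_goals omega

end LowerBound

section MonomialUpperBound

open RingTheory.Sequence

universe u

variable {σ : Type} {K : Type u} [Field K] {U : Set (σ →₀ ℕ)}

lemma mul_mem_of_forall_X_mul_mem {Q : Ideal (MvPolynomial σ K)} {S : Set σ}
    {f : MvPolynomial σ K} (h : ∀ a ∈ S, X a * f ∈ Q) :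
    ∀ s ∈ Ideal.span (X '' S), s * f ∈ Q := by
  intro s hs
  have hle : Ideal.span (X '' S) ≤ Submodule.comap (LinearMap.mulRight _ f) Q := by
    rw [Ideal.span_le]
    rintro _ ⟨a, ha, rfl⟩
    exact h a ha
  exact hle hs

lemma ringKrullDim_quotient_span_X_le [Finite σ] (S : Set σ) :
    ringKrullDim (MvPolynomial σ K ⧸ Ideal.span (X '' S : Set (MvPolynomial σ K))) ≤
      (Sᶜ.ncard : WithBot ℕ∞) := by
  let φ : MvPolynomial (Sᶜ : Set σ) K →+*
      MvPolynomial σ K ⧸ Ideal.span (X '' S : Set (MvPolynomial σ K)) :=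
    (Ideal.Quotient.mk (Ideal.span (X '' S : Set (MvPolynomial σ K)))).comp
      (rename Subtype.val : _ →ₐ[K] MvPolynomial σ K).toRingHom
  have hφ : Function.Surjective φ := by
    intro x
    obtain ⟨p, rfl⟩ := Ideal.Quotient.mk_surjective x
    induction p using MvPolynomial.induction_on with
    | C c => exact ⟨C c, by simp [φ]⟩
    | add p q hp hq =>
      obtain ⟨p', hp⟩ := hp
      obtain ⟨q', hq⟩ := hq
      exact ⟨p' + q', by rw [map_add, hp, hq, map_add]⟩
    | mul_X p a hp =>
      obtain ⟨p', hp⟩ := hp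
      by_cases ha : a ∈ S
      · refine ⟨0, ?_⟩
        rw [map_zero, eq_comm, Ideal.Quotient.eq_zero_iff_mem]
        exact Ideal.mul_mem_left _ _ (Ideal.subset_span ⟨a, ha, rfl⟩)
      · refine ⟨p' * X ⟨a, ha⟩, ?_⟩
        rw [map_mul, hp, map_mul]
        simp [φ]
  refine (ringKrullDim_le_of_surjective φ hφ).trans ?_
  rw [MvPolynomial.ringKrullDim_of_isNoetherianRing, ringKrullDim_eq_zero_of_field, zero_add,
    Nat.card_coe_set_eq]

/-- A monomial `e` with `P₁ P₂ e ⊆ I`, for ideals `P₁`, `P₂` generated by variables, whose class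
modulo `I` is not a sum of elements killed by `P₁` and by `P₂`, bounds the depth of `S/I`. -/
lemma length_le_ncard_compl_add_one [Finite σ] (hU : IsUpperSet U) (h0 : 0 ∉ U) {S₁ S₂ : Set σ}
    {e : σ →₀ ℕ}
    (he : ∀ a ∈ S₁, ∀ b ∈ S₂, e + Finsupp.single a 1 + Finsupp.single b 1 ∈ U)
    {a b : σ} (ha : a ∈ S₁) (hb : b ∈ S₂) (hae : e + Finsupp.single a 1 ∉ U)
    (hbe : e + Finsupp.single b 1 ∉ U) {rs : List (MvPolynomial σ K)}
    (hmem : ∀ r ∈ rs, r ∈ maxIdeal σ K)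
    (hreg : IsRegular (MvPolynomial σ K ⧸ monoIdeal K U) rs) :
    rs.length ≤ (S₁ ∪ S₂)ᶜ.ncard + 1 := by
  have hX : ∀ S : Set σ, Ideal.span (X '' S) ≤ maxIdeal σ K := fun S =>
    Ideal.span_mono (Set.image_subset_range _ _)
  have hXmul : ∀ (c : σ) (f : MvPolynomial σ K), X c * f ∈ monoIdeal K U ↔
      ∀ s, coeff s f ≠ 0 → s + Finsupp.single c 1 ∈ U := fun c f =>
    monomial_mul_mem_monoIdeal hU
  have hcoeff : ∀ (g : MvPolynomial σ K) (s : σ →₀ ℕ),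
      coeff s (g * monomial s 1) = coeff 0 g := fun g s => by
    simpa using coeff_mul_monomial 0 s (1 : K) g
  have : (maxIdeal σ K).IsPrime := isPrime_maxIdeal
  have key := length_le_ringKrullDim_add_one (m := maxIdeal σ K) (Q := monoIdeal K U)
    (P₁ := Ideal.span (X '' S₁)) (P₂ := Ideal.span (X '' S₂)) (e := monomial e 1)
    ?_ (hX _) (hX _) ?_ ?_ ?_ hmem hreg
  · rw [← Ideal.span_union, ← Set.image_union] at key
    have := key.trans (add_le_add_left (ringKrullDim_quotient_span_X_le (K := K) (S₁ ∪ S₂)) 1)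
    exact_mod_cast this
  · intro p hp
    rw [mem_maxIdeal_iff]
    by_contra h
    exact h0 ((mem_monoIdeal hU).mp hp 0 h)
  · intro s hs t ht
    rw [mul_assoc]
    refine mul_mem_of_forall_X_mul_mem (fun a ha => ?_) s hs
    rw [mul_left_comm]
    refine mul_mem_of_forall_X_mul_mem (fun b hb => ?_) t ht
    rw [X, X, monomial_mul, monomial_mul, one_mul, one_mul, monomial_mem_monoIdeal hU]
    convert he a ha b hb using 1
    abel
  · intro g v h1 h2
    have h1 := (hXmul a _).mp (h1 _ (Ideal.subset_span ⟨a, ha, rfl⟩)) e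
    have h2 := (hXmul b _).mp (h2 _ (Ideal.subset_span ⟨b, hb, rfl⟩)) e
    have h1 : coeff e (g * monomial e 1 - v) = 0 := by
      by_contra h
      exact hae (h1 h)
    have h2 : coeff e v = 0 := by
      by_contra h
      exact hbe (h2 h)
    rwa [coeff_sub, h2, sub_zero, hcoeff, ← mem_maxIdeal_iff] at h1
  · intro f hf hPf
    rw [← Ideal.span_union, ← Set.image_union] at *
    rw [mem_monoIdeal hU] at hf
    push Not at hf
    obtain ⟨s, hs, hsU⟩ := hf
    refine ⟨monomial s 1, mul_mem_of_forall_X_mul_mem fun c hc => ?_, fun g hg => ?_⟩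
    · have := (hXmul c f).mp (hPf _ (Ideal.subset_span ⟨c, hc, rfl⟩)) s hs
      rwa [X, monomial_mul, one_mul, monomial_mem_monoIdeal hU, add_comm]
    · rw [mem_maxIdeal_iff]
      by_contra h
      exact hsU ((mem_monoIdeal hU).mp hg s (by rwa [hcoeff]))

end MonomialUpperBound

section Witness

variable {V : Type} {G : SimpleGraph V} {c : V → Bool} {m : ℕ}

/-- Data witnessing the depth drop of the power `m + 1`: a monomial `e` of degree `2 m` in the
variables `x_i`, `i ∈ T`. -/
structure DepthWitness [Fintype V] (G : SimpleGraph V) (c : V → Bool) (m : ℕ) (T : Finset V)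
    (e : V ⊕ V →₀ ℕ) : Prop where
  card_eq : T.card = m + 1
  degree_eq : e.degree = 2 * m
  inl_eq_zero : ∀ i ∉ T, e (Sum.inl i) = 0
  mem : e ∈ powSet (whiskerGens G Finset.univ) m
  same : ∀ i ∈ T, ∀ j ∈ T, c i = c j → ∀ t, xExp j + t ∈ whiskerGens G Finset.univ →
    e + xExp i + t ∈ powSet (whiskerGens G Finset.univ) (m + 1)
  opp : ∀ i ∈ T, ∀ j ∈ T, c i ≠ c j →
    e + xExp i + xExp j ∈ powSet (whiskerGens G Finset.univ) (m + 1)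
  opp_nbr : ∀ i ∈ T, ∀ j ∈ T, c i ≠ c j → ∀ s t, xExp i + s ∈ whiskerGens G Finset.univ →
    xExp j + t ∈ whiskerGens G Finset.univ →
    e + s + t ∈ powSet (whiskerGens G Finset.univ) (m + 1)

lemma mem_whiskerGens_of_forall_notMem {A T : Finset V} {g : V ⊕ V →₀ ℕ}
    (hg : g ∈ whiskerGens G A) (h : ∀ i ∉ T, g (Sum.inl i) = 0) : g ∈ whiskerGens G T := by
  rcases hg with ⟨i, -, j, -, hij, rfl⟩ | ⟨i, -, rfl⟩
  · refine Or.inl ⟨i, ?_, j, ?_, hij, rfl⟩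
    · by_contra hi
      simpa using h i hi
    · by_contra hj
      simpa using h j hj
  · refine Or.inr ⟨i, ?_, rfl⟩
    by_contra hi
    simpa using h i hi

variable [Fintype V]

lemma depthWitness_singleton (r : V) : DepthWitness G c 0 {r} 0 where
  card_eq := by simp
  degree_eq := by simp
  inl_eq_zero := by simp
  mem := trivial
  same i hi j hj _ t ht := by
    obtain rfl := Finset.mem_singleton.mp hi
    obtain rfl := Finset.mem_singleton.mp hj
    exact ⟨_, ht, 0, trivial, (add_assoc _ _ _).ge⟩
  opp i hi j hj h := by
    obtain rfl := Finset.mem_singleton.mp hi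
    obtain rfl := Finset.mem_singleton.mp hj
    exact absurd rfl h
  opp_nbr i hi j hj h := by
    obtain rfl := Finset.mem_singleton.mp hi
    obtain rfl := Finset.mem_singleton.mp hj
    exact absurd rfl h

variable [DecidableEq V]

lemma DepthWitness.insert {T : Finset V} {e : V ⊕ V →₀ ℕ} (h : DepthWitness G c m T e)
    (hc : ∀ i j, G.Adj i j → c i ≠ c j) {p l : V} (hp : p ∈ T) (hl : l ∉ T) (hpl : G.Adj p l) :
    DepthWitness G c (m + 1) (insert l T) (e + (xExp p + xExp l)) := by
  have hcl : c p ≠ c l := hc p l hpl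
  have hbool : ∀ {a b d : Bool}, a ≠ d → b ≠ d → a = b := by decide
  have hg : xExp p + xExp l ∈ whiskerGens G Finset.univ :=
    Or.inl ⟨p, Finset.mem_univ _, l, Finset.mem_univ _, hpl, rfl⟩
  have hadd : ∀ {a b g : V ⊕ V →₀ ℕ}, g ∈ whiskerGens G Finset.univ →
      a ∈ powSet (whiskerGens G Finset.univ) (m + 1) → a + g = b →
      b ∈ powSet (whiskerGens G Finset.univ) (m + 1 + 1) := fun hg ha hb =>
    hb ▸ add_mem_powSet_succ ha hg
  constructor
  · rw [Finset.card_insert_of_notMem hl, h.card_eq]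
  · rw [map_add, map_add, h.degree_eq, Finsupp.degree_single, Finsupp.degree_single]
    ring
  · intro i hi
    rw [Finset.mem_insert, not_or] at hi
    have hip : p ≠ i := by
      rintro rfl
      exact hi.2 hp
    simp [h.inl_eq_zero i hi.2, hip, Ne.symm hi.1]
  · exact add_mem_powSet_succ h.mem hg
  · intro i hi j hj hij t ht
    rcases Finset.mem_insert.mp hi with rfl | hi' <;>
      rcases Finset.mem_insert.mp hj with rfl | hj'
    · exact hadd ht (add_mem_powSet_succ h.mem hg) (by abel)
    · exact hadd hg (h.opp_nbr p hp j hj' (hij ▸ hcl) _ _ hg ht) (by abel)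
    · exact hadd ht (h.opp i hi' p hp (hij ▸ hcl.symm)) (by abel)
    · exact hadd hg (h.same i hi' j hj' hij t ht) (by abel)
  · intro i hi j hj hij
    rcases Finset.mem_insert.mp hi with rfl | hi' <;>
      rcases Finset.mem_insert.mp hj with rfl | hj'
    · exact absurd rfl hij
    · exact hadd hg (h.same j hj' p hp (hbool hij.symm hcl) _ hg) (by abel)
    · exact hadd hg (h.same i hi' p hp (hbool hij hcl) _ hg) (by abel)
    · exact hadd hg (h.opp i hi' j hj' hij) (by abel)
  · intro i hi j hj hij s t hs ht
    rcases Finset.mem_insert.mp hi with rfl | hi' <;>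
      rcases Finset.mem_insert.mp hj with rfl | hj'
    · exact absurd rfl hij
    · exact hadd hs (h.same p hp j hj' (hbool hcl hij.symm) t ht) (by abel)
    · exact hadd ht (h.same p hp i hi' (hbool hcl hij) s hs) (by abel)
    · exact hadd hg (h.opp_nbr i hi' j hj' hij s t hs ht) (by abel)

lemma exists_depthWitness (hG : G.Connected) (hc : ∀ i j, G.Adj i j → c i ≠ c j) (r : V)
    (hm : m < Fintype.card V) : ∃ T e, r ∈ T ∧ DepthWitness G c m T e := by
  induction m with
  | zero => exact ⟨_, _, Finset.mem_singleton_self r, depthWitness_singleton r⟩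
  | succ m ih =>
    obtain ⟨T, e, hr, h⟩ := ih (by omega)
    obtain ⟨z, hz⟩ : ∃ z, z ∉ T := by
      by_contra! hT
      have := h.card_eq
      rw [Finset.eq_univ_of_forall hT, Finset.card_univ] at this
      omega
    obtain ⟨p⟩ := hG.preconnected r z
    obtain ⟨d, -, hd₁, hd₂⟩ := p.exists_boundary_dart (T : Set V) hr hz
    exact ⟨_, _, Finset.mem_insert_of_mem hr, h.insert hc hd₁ hd₂ d.adj⟩

/-- The monomial `e ∏_{w ∉ T} y_w` times a variable at a vertex of `T` is not in the power. -/
lemma DepthWitness.add_single_notMem {T : Finset V} {e : V ⊕ V →₀ ℕ}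
    (h : DepthWitness G c m T e) {a : V ⊕ V} (ha : ∀ i ∉ T, a ≠ Sum.inl i) :
    e + (∑ w ∈ Tᶜ, yExp w) + Finsupp.single a 1 ∉ powSet (whiskerGens G Finset.univ) (m + 1) := by
  intro hmem
  have h0 : ∀ i ∉ T,
      (e + (∑ w ∈ Tᶜ, yExp w) + Finsupp.single a 1 : V ⊕ V →₀ ℕ) (Sum.inl i) = 0 := by
    intro i hi
    simp [h.inl_eq_zero i hi, Finsupp.single_eq_of_ne (ha i hi).symm]
  have hmem := powSet_restrict (F := whiskerGens G T) hmem fun g hg hle =>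
    mem_whiskerGens_of_forall_notMem hg fun i hi => eq_zero_of_le_of_eq_zero hle (h0 i hi)
  let φ : (V ⊕ V →₀ ℕ) →+ ℕ := ∑ b ∈ T.disjSum T, Finsupp.applyAddHom b
  have hφ : ∀ t, φ t = ∑ b ∈ T.disjSum T, t b := fun t => by simp [φ]
  have hφdeg : ∀ t, φ t ≤ t.degree := fun t => by
    rw [hφ, Finsupp.degree_eq_sum]
    exact Finset.sum_le_univ_sum_of_nonneg fun _ => Nat.zero_le _
  have hφx : ∀ i ∈ T, φ (xExp i) = 1 := fun i hi => by
    simp [hφ, Finsupp.single_apply, hi]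
  have hφy : ∀ i, φ (yExp i) = if i ∈ T then 1 else 0 := fun i => by
    simp [hφ, Finsupp.single_apply]
  have hlow := le_of_mem_powSet φ (c := 2) ?_ hmem
  · have h1 : φ (∑ w ∈ Tᶜ, yExp w) = 0 := by
      rw [map_sum]
      exact Finset.sum_eq_zero fun w hw => by rw [hφy, if_neg (Finset.mem_compl.mp hw)]
    have h2 := hφdeg e
    have h3 := hφdeg (Finsupp.single a 1)
    rw [h.degree_eq] at h2
    rw [Finsupp.degree_single] at h3
    rw [map_add, map_add, h1] at hlow
    omega
  · rintro g (⟨i, hi, j, hj, -, rfl⟩ | ⟨i, hi, rfl⟩)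
    · rw [map_add, hφx i hi, hφx j hj]
    · rw [map_add, hφx i hi, hφy, if_pos hi]

end Witness

section WhiskerDepth

open RingTheory.Sequence

universe u

variable {K : Type u} [Field K]

lemma length_le_of_isRegular_whisker {V : Type} [Fintype V] {G : SimpleGraph V} (hG : G.IsTree)
    {m : ℕ} (hm : m < Fintype.card V) {rs : List (MvPolynomial (V ⊕ V) K)}
    (hmem : ∀ r ∈ rs, r ∈ maxIdeal (V ⊕ V) K)
    (hreg : IsRegular
      (MvPolynomial (V ⊕ V) K ⧸ monoIdeal K (powSet (whiskerGens G Finset.univ) (m + 1))) rs) :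
    rs.length ≤ Fintype.card V - (m + 1) + 1 := by
  classical
  obtain ⟨C⟩ := hG.isAcyclic.isBipartite
  let c : V → Bool := fun i => C i = 0
  have hc : ∀ i j, G.Adj i j → c i ≠ c j := by
    intro i j hij
    have := C.valid hij
    simp only [c, ne_eq, decide_eq_decide]
    omega
  obtain ⟨r⟩ := hG.connected.nonempty
  obtain ⟨T, e, hr, h⟩ := exists_depthWitness hG.connected hc r hm
  have hU := isUpperSet_powSet (whiskerGens G Finset.univ) (m + 1)
  let S : Bool → Set (V ⊕ V) := fun b =>
    {a | ∃ i ∈ T, (c i = b ∧ a = Sum.inl i) ∨ (c i ≠ b ∧ a = Sum.inr i)}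
  let N : Set (V ⊕ V) := {a | ∃ i ∉ T, a = Sum.inl i}
  have hY : ∀ i : V, xExp i + yExp i ∈ whiskerGens G Finset.univ := fun i =>
    Or.inr ⟨i, Finset.mem_univ _, rfl⟩
  have hbool : ∀ {a b : Bool}, a ≠ true → b ≠ false → a ≠ b := by decide
  have hpair : ∀ a ∈ S true ∪ N, ∀ b ∈ S false,
      e + (∑ w ∈ Tᶜ, yExp w) + Finsupp.single a 1 + Finsupp.single b 1 ∈
        powSet (whiskerGens G Finset.univ) (m + 1) := by
    intro a ha b hb
    have hle : e + Finsupp.single a 1 + Finsupp.single b 1 ≤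
        e + (∑ w ∈ Tᶜ, yExp w) + Finsupp.single a 1 + Finsupp.single b 1 := by
      gcongr
      exact le_self_add
    rcases ha with ⟨i, hi, ha⟩ | ⟨i, hi, rfl⟩
    · refine hU hle ?_
      obtain ⟨j, hj, hb⟩ := hb
      rcases ha with ⟨hci, rfl⟩ | ⟨hci, rfl⟩ <;> rcases hb with ⟨hcj, rfl⟩ | ⟨hcj, rfl⟩
      · exact h.opp i hi j hj (by simp [hci, hcj])
      · exact h.same i hi j hj (hci.trans (Bool.eq_true_of_not_eq_false hcj).symm) _ (hY j)
      · rw [add_right_comm]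
        exact h.same j hj i hi (hcj.trans (Bool.eq_false_of_not_eq_true hci).symm) _ (hY i)
      · exact h.opp_nbr i hi j hj (hbool hci hcj) _ _ (hY i) (hY j)
    · refine hU ?_ (add_mem_powSet_succ h.mem (hY i))
      have hy : yExp i ≤ ∑ w ∈ Tᶜ, yExp w :=
        Finset.single_le_sum (f := fun w => yExp w) (fun _ _ => zero_le)
          (Finset.mem_compl.mpr hi)
      calc e + (xExp i + yExp i) = e + yExp i + xExp i := by abel
        _ ≤ e + (∑ w ∈ Tᶜ, yExp w) + xExp i := by gcongr
        _ ≤ _ := le_self_add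
  have hS : ∀ b, ∃ a ∈ S b, ∀ i ∉ T, a ≠ Sum.inl i := by
    intro b
    by_cases hb : c r = b
    · refine ⟨Sum.inl r, ⟨r, hr, Or.inl ⟨hb, rfl⟩⟩, ?_⟩
      rintro i hi hri
      exact hi (Sum.inl_injective hri ▸ hr)
    · exact ⟨Sum.inr r, ⟨r, hr, Or.inr ⟨hb, rfl⟩⟩, fun _ _ => Sum.inr_ne_inl⟩
  obtain ⟨a, ha, haT⟩ := hS true
  obtain ⟨b, hb, hbT⟩ := hS false
  have hcompl : (S true ∪ N ∪ S false)ᶜ ⊆ ((Tᶜ.map Function.Embedding.inr : Finset (V ⊕ V)) :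
      Set (V ⊕ V)) := by
    rintro (i | i) hi
    · refine absurd ?_ hi
      by_cases hiT : i ∈ T
      · cases hci : c i
        · exact Or.inr ⟨i, hiT, Or.inl ⟨hci, rfl⟩⟩
        · exact Or.inl (Or.inl ⟨i, hiT, Or.inl ⟨hci, rfl⟩⟩)
      · exact Or.inl (Or.inr ⟨i, hiT, rfl⟩)
    · suffices i ∉ T by simpa using this
      intro hiT
      refine hi ?_
      cases hci : c i
      · exact Or.inl (Or.inl ⟨i, hiT, Or.inr ⟨by simp [hci], rfl⟩⟩)
      · exact Or.inr ⟨i, hiT, Or.inr ⟨by simp [hci], rfl⟩⟩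
  have hcard := Set.ncard_le_ncard hcompl
  rw [Set.ncard_coe_finset, Finset.card_map, Finset.card_compl, h.card_eq] at hcard
  have := length_le_ncard_compl_add_one hU (fun h0 => h.add_single_notMem haT (hU (zero_le) h0))
    hpair (Or.inl ha) hb (h.add_single_notMem haT) (h.add_single_notMem hbT) hmem hreg
  omega

lemma exists_isRegular_whisker {V : Type} [Fintype V] {G : SimpleGraph V} (hG : G.IsAcyclic)
    {k : ℕ} (hk : k ≠ 0) :
    ∃ rs : List (MvPolynomial (V ⊕ V) K), rs.length = Fintype.card V + 1 - k ∧
      (∀ r ∈ rs, r ∈ maxIdeal (V ⊕ V) K) ∧ IsRegular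
        (MvPolynomial (V ⊕ V) K ⧸ monoIdeal K (powSet (whiskerGens G Finset.univ) k)) rs := by
  classical
  have hd := monoDepth_whisker (K := K) hG Finset.univ ∅ (by simp) k
  have hZ : meets (∅ : Finset (V ⊕ V)) = ∅ := by
    ext
    simp [meets]
  rw [hZ, Set.union_empty, Finset.card_univ, Finset.card_empty, Nat.sub_self, Nat.sub_zero,
    add_zero] at hd
  have hU := isUpperSet_powSet (whiskerGens G Finset.univ) k
  have hle : monoIdeal K (powSet (whiskerGens G Finset.univ) k) ≤ maxIdeal (V ⊕ V) K := by
    intro p hp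
    rw [mem_maxIdeal_iff]
    by_contra h
    have := le_of_mem_powSet Finsupp.degree (c := 2) ?_ ((mem_monoIdeal hU).mp hp 0 h)
    · simp only [map_zero] at this
      omega
    · rintro g (⟨i, -, j, -, -, rfl⟩ | ⟨i, -, rfl⟩) <;> simp
  exact ExtVanishes.exists_isRegular (Ideal.smul_top_lt_top_of_surjective isPrime_maxIdeal.ne_top
    (Submodule.factor hle) (Submodule.factor_surjective hle)) hd

lemma whiskerEdgeIdeal_pow {n : ℕ} (G : SimpleGraph (Fin n)) (k : ℕ) :
    whiskerEdgeIdeal K G ^ k = monoIdeal K (powSet (whiskerGens G Finset.univ) k) := by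
  rw [← span_monomial_pow, whiskerEdgeIdeal]
  congr 2
  ext p
  simp only [Set.mem_union, Set.mem_ofPred_eq, Set.mem_range, Set.mem_image, whiskerGens,
    Finset.mem_univ, true_and, X, monomial_mul, one_mul]
  constructor
  · rintro (⟨i, j, hij, rfl⟩ | ⟨i, rfl⟩)
    · exact ⟨_, Or.inl ⟨i, j, hij, rfl⟩, rfl⟩
    · exact ⟨_, Or.inr ⟨i, rfl⟩, rfl⟩
  · rintro ⟨_, ⟨i, j, hij, rfl⟩ | ⟨i, rfl⟩, rfl⟩
    · exact Or.inl ⟨i, j, hij, rfl⟩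
    · exact Or.inr ⟨i, rfl⟩

end WhiskerDepth

/-- Herzog–Hibi–Qureshi, Corollary: if `G` is a tree on `n` vertices, then
`depth(S*/I(G*)^k) = n - k + 1` for `k = 1, …, n`. -/
theorem depth_whisker_power_of_tree {n : ℕ} (K : Type*) [Field K]
    (G : SimpleGraph (Fin n)) (hG : G.IsTree) (k : ℕ) (hk1 : 1 ≤ k) (hkn : k ≤ n) :
    idealDepth (maxIdeal (Fin n ⊕ Fin n) K)
      (MvPolynomial (Fin n ⊕ Fin n) K ⧸ (whiskerEdgeIdeal K G) ^ k) = n - k + 1 := by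
  rw [whiskerEdgeIdeal_pow]
  refine IsGreatest.csSup_eq ⟨?_, ?_⟩
  · obtain ⟨rs, hlen, hrs⟩ := exists_isRegular_whisker (K := K) hG.isAcyclic (k := k) (by omega)
    refine ⟨rs, ?_, hrs⟩
    rw [hlen, Fintype.card_fin]
    omega
  · rintro d ⟨rs, rfl, hmem, hreg⟩
    obtain ⟨m, rfl⟩ := Nat.exists_eq_add_of_le' hk1
    simpa using length_le_of_isRegular_whisker hG (by simpa using hkn) hmem hreg
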